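/- Let n ≥ 2, let S = {σ(t) : t ∈ D} be a rationally parameterisable hypersurface in ℝⁿ, and let O be a nonempty open subset of D in ℝ^{n−1} such that σ(O) is not contained in any affine hyperplane of ℝⁿ. Let v₁,…,v_m be distinct points of ℝⁿ, and for each k ∈ {1,…,m} let P_k = A_k/B_k be a rational function in n variables with complex coefficients such that B_k(x) ≠ 0 for all x ∈ σ(O). If ∑_{k=1}^m P_k(x) · exp(−i v_k·x) = 0 for every x ∈ σ(O), then P_k(x) = 0 for every x ∈ σ(O) and every k ∈ {1,…,m}. -/

import Mathlib

open scoped RealInnerProductSpace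

open Polynomial in
theorem rp_loc (f g r d : ℂ[X]) (a : ℂ) (hf : f ≠ 0) (hg : g ≠ 0) (hd : d ≠ 0)
    (hda : d.IsRoot a) (hra : r.eval a ≠ 0)
    (h : d ^ 2 * (f * derivative g - g * derivative f) +
      f * g * (derivative r * d - r * derivative d) = 0) : False := by
  obtain ⟨f1, hf1, hf2⟩ := Polynomial.exists_eq_pow_rootMultiplicity_mul_and_not_dvd f hf a
  obtain ⟨g1, hg1, hg2⟩ := Polynomial.exists_eq_pow_rootMultiplicity_mul_and_not_dvd g hg a
  obtain ⟨d1, hd1, hd2⟩ := Polynomial.exists_eq_pow_rootMultiplicity_mul_and_not_dvd d hd a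
  have hm : 0 < d.rootMultiplicity a := (Polynomial.rootMultiplicity_pos hd).2 hda
  generalize f.rootMultiplicity a = i at *
  generalize g.rootMultiplicity a = j at *
  generalize d.rootMultiplicity a = m at *
  rw [Polynomial.dvd_iff_isRoot, Polynomial.IsRoot.def] at hf2 hg2 hd2
  have key : ∀ (n : ℕ) (x : ℂ[X]), (X - C a) * derivative ((X - C a) ^ n * x) =
      (X - C a) ^ n * ((n : ℂ[X]) * x + (X - C a) * derivative x) := by
    intro n x
    cases n with
    | zero => simp
    | succ n =>
      simp only [derivative_mul, derivative_X_sub_C_pow]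
      simp only [Nat.add_sub_cancel, map_natCast]
      push_cast
      ring
  have kf := key i f1
  have kg := key j g1
  have kd := key m d1
  rw [← hf1] at kf
  rw [← hg1] at kg
  rw [← hd1] at kd
  set Y := X - C a with hY
  have hY0 : Y ≠ 0 := X_sub_C_ne_zero a
  have e : Y ^ (i + j + m) * (Y ^ m * (d1 ^ 2 * (f1 * ((j : ℂ[X]) * g1 + Y * derivative g1)
      - g1 * ((i : ℂ[X]) * f1 + Y * derivative f1))) +
      f1 * g1 * (Y * derivative r * d1 - r * ((m : ℂ[X]) * d1 + Y * derivative d1))) = 0 := by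
    have h2 : d ^ 2 * (f * (Y * derivative g) - g * (Y * derivative f)) +
      f * g * (Y * derivative r * d - r * (Y * derivative d)) = 0 := by
      linear_combination Y * h
    rw [kf, kg, kd] at h2
    rw [← h2]
    conv_rhs => rw [hf1, hg1, hd1]
    ring
  have e2 := (mul_eq_zero.1 e).resolve_left (pow_ne_zero _ hY0)
  have e3 := congrArg (Polynomial.eval a) e2
  simp [hY, hm.ne', hf2, hg2, hd2, hra] at e3

open Polynomial in
theorem rp_alg (f g r d : ℂ[X]) (hf : f ≠ 0) (hg : g ≠ 0) (hd : d ≠ 0)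
    (h : d ^ 2 * (f * derivative g - g * derivative f) +
      f * g * (derivative r * d - r * derivative d) = 0) : ∃ c : ℂ, r = C c * d := by
  obtain ⟨r1, hr1⟩ := EuclideanDomain.gcd_dvd_left r d
  obtain ⟨d1, hd1⟩ := EuclideanDomain.gcd_dvd_right r d
  have hbz := EuclideanDomain.gcd_eq_gcd_ab r d
  generalize EuclideanDomain.gcdA r d = x at *
  generalize EuclideanDomain.gcdB r d = y at *
  generalize EuclideanDomain.gcd r d = k at *
  subst hr1
  subst hd1
  have hk : k ≠ 0 := left_ne_zero_of_mul hd
  have hd10 : d1 ≠ 0 := right_ne_zero_of_mul hd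
  have hb : r1 * x + d1 * y = 1 := by
    apply mul_left_cancel₀ hk
    linear_combination -hbz
  have h1 : d1 ^ 2 * (f * derivative g - g * derivative f) +
      f * g * (derivative r1 * d1 - r1 * derivative d1) = 0 := by
    apply mul_left_cancel₀ (pow_ne_zero 2 hk)
    simp only [derivative_mul] at h
    linear_combination h
  by_cases hdeg : d1.degree = 0
  · obtain ⟨c, hc⟩ : ∃ c, d1 = C c := ⟨_, eq_C_of_degree_eq_zero hdeg⟩
    subst hc
    have hc : c ≠ 0 := by
      rintro rfl
      simp at hd10
    have h2 : f * g * derivative r1 = - (C c * (f * derivative g - g * derivative f)) := by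
      apply mul_left_cancel₀ hd10
      simp only [derivative_C] at h1
      linear_combination h1
    have hr' : derivative r1 = 0 := by
      by_contra hne
      have e1 : (f * derivative g).degree < (f * g).degree := by
        rw [degree_mul, degree_mul]
        exact WithBot.add_lt_add_left (degree_ne_bot.2 hf) (degree_derivative_lt hg)
      have e2 : (g * derivative f).degree < (f * g).degree := by
        rw [mul_comm f g, degree_mul, degree_mul]
        exact WithBot.add_lt_add_left (degree_ne_bot.2 hg) (degree_derivative_lt hf)
      have e3 : (f * g * derivative r1).degree < (f * g).degree := by
        rw [h2, degree_neg, degree_C_mul hc]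
        exact (degree_sub_le _ _).trans_lt (max_lt e1 e2)
      exact absurd e3 (not_lt.2 (degree_le_mul_left _ hne))
    obtain ⟨b, hb'⟩ : ∃ b, r1 = C b := ⟨_, eq_C_of_derivative_eq_zero hr'⟩
    subst hb'
    refine ⟨b / c, ?_⟩
    rw [div_eq_mul_inv, C_mul]
    have : (C c⁻¹ : ℂ[X]) * C c = 1 := by rw [← C_mul, inv_mul_cancel₀ hc, C_1]
    linear_combination (-(k * C b)) * this
  · exfalso
    obtain ⟨a, ha⟩ := IsAlgClosed.exists_root d1 hdeg
    refine rp_loc f g r1 d1 a hf hg hd10 ha ?_ h1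
    intro h0
    have := congrArg (eval a) hb
    rw [IsRoot.def] at ha
    simp [h0, ha] at this

open Polynomial Filter Topology in
theorem rp_one {ι : Type*} [DecidableEq ι] (r : ι → ℂ[X]) (d : ℂ[X]) (hd : d.eval 0 ≠ 0)
    (K : Finset ι)
    (hne : ∀ k ∈ K, ∀ l ∈ K, k ≠ l → ¬ ∃ c : ℂ, r k - r l = C c * d) :
    ∀ (p : ι → ℂ[X])
    (_ : ∀ᶠ s : ℝ in 𝓝 0, ∑ k ∈ K, (p k).eval (s : ℂ) *
      Complex.exp ((r k).eval (s : ℂ) / d.eval (s : ℂ)) = 0), ∀ k ∈ K, p k = 0 := by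
  have hd0 : d ≠ 0 := by
    rintro rfl
    simp at hd
  have hdev : ∀ᶠ s : ℝ in 𝓝 0, d.eval (s : ℂ) ≠ 0 := by
    have hc : ContinuousAt (fun s : ℝ => d.eval (s : ℂ)) 0 :=
      (d.continuous.comp Complex.continuous_ofReal).continuousAt
    exact hc.eventually_ne (by simpa using hd)
  induction K using Finset.induction_on with
  | empty => simp
  | insert k0 K hk0 ih =>
    intro p hp
    have ih' := ih (fun k hk l hl => hne k (Finset.mem_insert_of_mem hk) l
      (Finset.mem_insert_of_mem hl))
    by_cases h0 : p k0 = 0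
    · have := ih' p (by
        filter_upwards [hp] with s hs
        rw [Finset.sum_insert hk0] at hs
        simpa [h0] using hs)
      intro k hk
      rcases Finset.mem_insert.1 hk with rfl | hk
      · exact h0
      · exact this k hk
    -- the derivative relation
    have hder : ∀ᶠ s : ℝ in 𝓝 0, ∑ k ∈ insert k0 K,
        (d ^ 2 * derivative (p k) + p k * (derivative (r k) * d - r k * derivative d)).eval (s : ℂ)
          * Complex.exp ((r k).eval (s : ℂ) / d.eval (s : ℂ)) = 0 := by
      filter_upwards [hp.eventually_nhds, hdev] with s hs hds
      have hh : HasDerivAt (fun s : ℝ => ∑ k ∈ insert k0 K, (p k).eval (s : ℂ) *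
          Complex.exp ((r k).eval (s : ℂ) / d.eval (s : ℂ)))
          (∑ k ∈ insert k0 K, ((derivative (p k)).eval (s : ℂ) *
            Complex.exp ((r k).eval (s : ℂ) / d.eval (s : ℂ)) + (p k).eval (s : ℂ) *
            (Complex.exp ((r k).eval (s : ℂ) / d.eval (s : ℂ)) *
            (((derivative (r k)).eval (s : ℂ) * d.eval (s : ℂ) -
              (r k).eval (s : ℂ) * (derivative d).eval (s : ℂ)) / d.eval (s : ℂ) ^ 2)))) s := by
        apply HasDerivAt.fun_sum
        intro k _
        have h1 := ((p k).hasDerivAt (s : ℂ)).mul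
          ((((r k).hasDerivAt (s : ℂ)).div (d.hasDerivAt (s : ℂ)) hds).cexp)
        exact h1.comp_ofReal
      have hz : HasDerivAt (fun s : ℝ => ∑ k ∈ insert k0 K, (p k).eval (s : ℂ) *
          Complex.exp ((r k).eval (s : ℂ) / d.eval (s : ℂ))) 0 s :=
        (hasDerivAt_const s (0 : ℂ)).congr_of_eventuallyEq hs
      have := hh.unique hz
      have h2 := congrArg (fun z => d.eval (s : ℂ) ^ 2 * z) this
      simp only [mul_zero, Finset.mul_sum] at h2
      rw [← h2]
      refine Finset.sum_congr rfl fun k _ => ?_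
      simp only [eval_add, eval_mul, eval_sub, eval_pow]
      field_simp
    have hel := ih' (fun k => p k0 * (d ^ 2 * derivative (p k) +
        p k * (derivative (r k) * d - r k * derivative d)) -
        p k * (d ^ 2 * derivative (p k0) +
        p k0 * (derivative (r k0) * d - r k0 * derivative d))) (by
      filter_upwards [hp, hder] with s h1 h2
      rw [Finset.sum_insert hk0] at h1 h2
      simp only [eval_sub, eval_mul (p := p _), sub_mul, Finset.sum_sub_distrib, mul_assoc]
      have e1 : ∀ (z : ℂ) (w : ι → ℂ), ∑ k ∈ K, z * w k = z * ∑ k ∈ K, w k :=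
        fun z w => (Finset.mul_sum _ _ _).symm
      have e2 : ∑ k ∈ K, (p k).eval (s : ℂ) * ((d ^ 2 * derivative (p k0) +
        p k0 * (derivative (r k0) * d - r k0 * derivative d)).eval (s : ℂ) *
          Complex.exp ((r k).eval (s : ℂ) / d.eval (s : ℂ))) =
          (d ^ 2 * derivative (p k0) +
        p k0 * (derivative (r k0) * d - r k0 * derivative d)).eval (s : ℂ) *
          ∑ k ∈ K, (p k).eval (s : ℂ) *
          Complex.exp ((r k).eval (s : ℂ) / d.eval (s : ℂ)) := by
        rw [Finset.mul_sum]
        exact Finset.sum_congr rfl fun k _ => by ring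
      rw [e1, e2]
      linear_combination (p k0).eval (s : ℂ) * h2 - (d ^ 2 * derivative (p k0) +
        p k0 * (derivative (r k0) * d - r k0 * derivative d)).eval (s : ℂ) * h1)
    have hK : ∀ k ∈ K, p k = 0 := by
      intro k hk
      by_contra hpk
      refine hne k (Finset.mem_insert_of_mem hk) k0 (Finset.mem_insert_self _ _)
        (fun e => hk0 (e ▸ hk)) ?_
      apply rp_alg (p k0) (p k) _ d h0 hpk hd0
      have := hel k hk
      simp only [derivative_sub]
      linear_combination this
    exfalso
    apply h0
    have hz : ∀ᶠ s : ℝ in 𝓝 0, (p k0).eval (s : ℂ) = 0 := by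
      filter_upwards [hp] with s hs
      rw [Finset.sum_insert hk0, Finset.sum_eq_zero (fun k hk => by simp [hK k hk]), add_zero] at hs
      exact (mul_eq_zero.1 hs).resolve_right (Complex.exp_ne_zero _)
    have hinf : {s : ℝ | (p k0).eval (s : ℂ) = 0}.Infinite :=
      infinite_of_mem_nhds 0 hz
    apply Polynomial.eq_zero_of_infinite_isRoot
    refine (hinf.image (Complex.ofReal_injective.injOn)).mono ?_
    rintro _ ⟨s, hs, rfl⟩
    exact hs

/-- Rational near zero. -/
def RpRat (f : ℝ → ℂ) : Prop :=
  ∃ p b : Polynomial ℂ, b.eval 0 ≠ 0 ∧ ∀ᶠ s : ℝ in nhds 0, f s * b.eval (s : ℂ) = p.eval (s : ℂ)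

theorem RpRat.add {f g : ℝ → ℂ} (hf : RpRat f) (hg : RpRat g) : RpRat (fun s => f s + g s) := by
  obtain ⟨p, b, hb, h⟩ := hf
  obtain ⟨p', b', hb', h'⟩ := hg
  refine ⟨p * b' + p' * b, b * b', by simp [hb, hb'], ?_⟩
  filter_upwards [h, h'] with s h h'
  simp only [Polynomial.eval_mul, Polynomial.eval_add, ← h, ← h']
  ring

theorem RpRat.mul {f g : ℝ → ℂ} (hf : RpRat f) (hg : RpRat g) : RpRat (fun s => f s * g s) := by
  obtain ⟨p, b, hb, h⟩ := hf
  obtain ⟨p', b', hb', h'⟩ := hg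
  refine ⟨p * p', b * b', by simp [hb, hb'], ?_⟩
  filter_upwards [h, h'] with s h h'
  simp only [Polynomial.eval_mul, ← h, ← h']
  ring

theorem RpRat.const (c : ℂ) : RpRat (fun _ => c) :=
  ⟨Polynomial.C c, 1, by simp, by simp⟩

theorem RpRat.mv {n : ℕ} (x : ℝ → Fin n → ℂ) (hx : ∀ j, RpRat (fun s => x s j))
    (P : MvPolynomial (Fin n) ℂ) : RpRat (fun s => MvPolynomial.eval (x s) P) := by
  induction P using MvPolynomial.induction_on with
  | C a => simpa using RpRat.const a
  | add p q hp hq => simpa using hp.add hq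
  | mul_X p i hp => simpa using hp.mul (hx i)

theorem RpRat.div {f g : ℝ → ℂ} (hf : RpRat f) (hg : RpRat g) (h0 : g 0 ≠ 0) :
    RpRat (fun s => f s / g s) := by
  obtain ⟨p, b, hb, h⟩ := hf
  obtain ⟨p', b', hb', h'⟩ := hg
  have e0 := h'.self_of_nhds
  have hp0 : p'.eval 0 ≠ 0 := by
    simp only [Complex.ofReal_zero] at e0
    rw [← e0]
    exact mul_ne_zero h0 hb'
  have hc : ContinuousAt (fun s : ℝ => p'.eval (s : ℂ)) 0 :=
    (p'.continuous.comp Complex.continuous_ofReal).continuousAt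
  have hev := hc.eventually_ne (by simpa using hp0)
  refine ⟨p * b', b * p', by simp [hb, hp0], ?_⟩
  filter_upwards [h, h', hev] with s h h' hne
  have hg : g s ≠ 0 := by
    intro h0
    rw [h0, zero_mul] at h'
    exact hne h'.symm
  simp only [Polynomial.eval_mul, ← h, ← h']
  field_simp

open Polynomial Filter Topology in
theorem rp_two {m : ℕ} (r : Fin m → ℂ[X]) (d : ℂ[X]) (hd : d.eval 0 ≠ 0)
    (hne : ∀ k l, k ≠ l → ¬ ∃ c : ℂ, r k - r l = C c * d)
    (F : Fin m → ℝ → ℂ) (hF : ∀ k, RpRat (F k))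
    (hz : ∀ᶠ s : ℝ in 𝓝 0, ∑ k, F k s *
      Complex.exp ((r k).eval (s : ℂ) / d.eval (s : ℂ)) = 0) (k : Fin m) : F k 0 = 0 := by
  choose p b hb h using hF
  have key := rp_one r d hd Finset.univ (fun k _ l _ => hne k l)
    (fun k => p k * ∏ l ∈ Finset.univ.erase k, b l) (by
      filter_upwards [hz, eventually_all.2 h] with s hs hall
      have h2 := congrArg (fun z => (∏ l, (b l).eval (s : ℂ)) * z) hs
      simp only [mul_zero, Finset.mul_sum] at h2
      rw [← h2]
      refine Finset.sum_congr rfl fun k _ => ?_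
      rw [← Finset.mul_prod_erase _ _ (Finset.mem_univ k), eval_mul, ← hall k, eval_prod]
      ring) k (Finset.mem_univ k)
  have hpk : p k = 0 := by
    refine (mul_eq_zero.1 key).resolve_right ?_
    refine Finset.prod_ne_zero_iff.2 ?_
    intro l _ h0
    apply hb l
    simp [h0]
  have := (h k).self_of_nhds
  simp only [hpk, Complex.ofReal_zero, eval_zero] at this
  exact (mul_eq_zero.1 this).resolve_right (hb k)

/-- with `n = q + 1 ≥ 2`. If a finite sum `∑ k, P_k(x) exp(-i v_k · x)` with
distinct frequencies `v_k` and rational-function coefficients `P_k = A_k / B_k` vanishes on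
`σ(O)`, where `σ` is a rationally parameterisable hypersurface and `O` is a nonempty open set
satisfying the hyperplane condition, then each `P_k` vanishes on `σ(O)`. -/
theorem exponential_sum_vanishing_on_rp_hypersurface
    (q : ℕ) (hq : 1 ≤ q)
    (D : Set (Fin q → ℝ))
    (σ : (Fin q → ℝ) → EuclideanSpace ℝ (Fin (q + 1)))
    -- each component of σ is a rational function whose denominator does not vanish on D
    (hrat : ∀ j : Fin (q + 1), ∃ A B : MvPolynomial (Fin q) ℝ,
      ∀ t ∈ D, MvPolynomial.eval t B ≠ 0 ∧
        σ t j = MvPolynomial.eval t A / MvPolynomial.eval t B)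
    (O : Set (Fin q → ℝ)) (hOopen : IsOpen O) (hOne : O.Nonempty) (hOD : O ⊆ D)
    -- hyperplane condition: σ(O) is not contained in an affine hyperplane
    (hhyp : ¬ ∃ (a : EuclideanSpace ℝ (Fin (q + 1))) (c : ℝ), a ≠ 0 ∧
      ∀ t ∈ O, ⟪a, σ t⟫ = c)
    (m : ℕ) (hm : 1 ≤ m)
    -- distinct points v₁, …, v_m of ℝⁿ
    (v : Fin m → EuclideanSpace ℝ (Fin (q + 1))) (hv : Function.Injective v)
    -- rational functions P_k = A_k / B_k with complex coefficients, defined on σ(O)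
    (A B : Fin m → MvPolynomial (Fin (q + 1)) ℂ)
    (hB : ∀ k, ∀ t ∈ O, MvPolynomial.eval (fun j => ((σ t j : ℝ) : ℂ)) (B k) ≠ 0)
    (hzero : ∀ t ∈ O,
      ∑ k : Fin m,
        (MvPolynomial.eval (fun j => ((σ t j : ℝ) : ℂ)) (A k) /
          MvPolynomial.eval (fun j => ((σ t j : ℝ) : ℂ)) (B k)) *
        Complex.exp (-Complex.I * ((⟪v k, σ t⟫ : ℝ) : ℂ)) = 0) :
    ∀ t ∈ O, ∀ k : Fin m,
      MvPolynomial.eval (fun j => ((σ t j : ℝ) : ℂ)) (A k) /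
        MvPolynomial.eval (fun j => ((σ t j : ℝ) : ℂ)) (B k) = 0 := by
  classical
  intro t0 ht0
  choose a b hab using hrat
  -- common denominator
  let d : MvPolynomial (Fin q) ℝ := ∏ j, b j
  let N : Fin (q + 1) → MvPolynomial (Fin q) ℝ := fun j => a j * ∏ i ∈ Finset.univ.erase j, b i
  let r : Fin m → MvPolynomial (Fin q) ℝ := fun k => ∑ j, MvPolynomial.C (v k j) * N j
  have hd : ∀ t ∈ O, MvPolynomial.eval t d ≠ 0 := by
    intro t ht
    simp only [d, map_prod]
    exact Finset.prod_ne_zero_iff.2 fun j _ => (hab j t (hOD ht)).1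
  have hN : ∀ t ∈ O, ∀ j, σ t j * MvPolynomial.eval t d = MvPolynomial.eval t (N j) := by
    intro t ht j
    obtain ⟨h1, h2⟩ := hab j t (hOD ht)
    simp only [d, N, map_mul, map_prod]
    rw [← Finset.mul_prod_erase _ _ (Finset.mem_univ j), h2]
    field_simp
  have hr : ∀ t ∈ O, ∀ k, (⟪v k, σ t⟫ : ℝ) * MvPolynomial.eval t d = MvPolynomial.eval t (r k) := by
    intro t ht k
    simp only [r, map_sum, map_mul, MvPolynomial.eval_C, ← hN t ht, PiLp.inner_apply,
      Finset.sum_mul]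
    refine Finset.sum_congr rfl fun j _ => ?_
    simp
    ring
  let M : Fin m → Fin m → MvPolynomial (Fin q) ℝ := fun k l =>
    (r k - r l) * MvPolynomial.C (MvPolynomial.eval t0 d) -
      MvPolynomial.C (MvPolynomial.eval t0 (r k - r l)) * d
  have hM : ∀ k l, k ≠ l → M k l ≠ 0 := by
    intro k l hkl h0
    refine hhyp ⟨v k - v l, MvPolynomial.eval t0 (r k - r l) / MvPolynomial.eval t0 d,
      sub_ne_zero.2 (fun e => hkl (hv e)), ?_⟩
    intro t ht
    have h1 := congrArg (MvPolynomial.eval t) h0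
    simp only [M, map_sub, map_mul, MvPolynomial.eval_C, map_zero] at h1
    have h2 := hr t ht k
    have h3 := hr t ht l
    have d0 := hd t0 ht0
    have d1 := hd t ht
    rw [inner_sub_left, eq_div_iff d0, map_sub]
    apply mul_left_cancel₀ d1
    rw [← h2, ← h3] at h1
    linear_combination h1
  obtain ⟨t1, ht1⟩ : ∃ t1, ∀ k l, k ≠ l → MvPolynomial.eval t1 (M k l) ≠ 0 := by
    have hprod : (∏ x ∈ (Finset.univ : Finset (Fin m)).offDiag, M x.1 x.2) ≠ 0 :=
      Finset.prod_ne_zero_iff.2 fun x hx => hM _ _ (Finset.mem_offDiag.1 hx).2.2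
    by_contra! hcon
    apply hprod
    apply MvPolynomial.funext
    intro t
    obtain ⟨k, l, hkl, h0⟩ := hcon t
    rw [map_prod, map_zero]
    exact Finset.prod_eq_zero (i := (k, l)) (by simp [hkl]) h0
  -- the line
  let L : ℝ → Fin q → ℝ := fun s i => t0 i + (t1 i - t0 i) * s
  have hL0 : L 0 = t0 := by ext i; simp [L]
  have hL1 : L 1 = t1 := by ext i; simp [L]
  have hLc : Continuous L := by fun_prop
  have hLO : ∀ᶠ s in nhds 0, L s ∈ O :=
    hLc.continuousAt.eventually_mem (by rw [hL0]; exact hOopen.mem_nhds ht0)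
  let φ : MvPolynomial (Fin q) ℝ →+* Polynomial ℂ :=
    MvPolynomial.eval₂Hom (Polynomial.C.comp Complex.ofRealHom)
      (fun i => Polynomial.C (t0 i : ℂ) + Polynomial.C ((t1 i - t0 i : ℝ) : ℂ) * Polynomial.X)
  have hφ : ∀ (s : ℝ) P, (φ P).eval (s : ℂ) = ((MvPolynomial.eval (L s) P : ℝ) : ℂ) := by
    intro s P
    induction P using MvPolynomial.induction_on with
    | C a => simp [φ]
    | add p q hp hq => simp [hp, hq]
    | mul_X p i hp =>
      rw [map_mul, Polynomial.eval_mul, hp]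
      simp [φ, L]
  have hφ0 : ∀ P, (φ P).eval 0 = ((MvPolynomial.eval t0 P : ℝ) : ℂ) := by
    intro P
    have := hφ 0 P
    rwa [hL0, Complex.ofReal_zero] at this
  have hφ1 : ∀ P, (φ P).eval 1 = ((MvPolynomial.eval t1 P : ℝ) : ℂ) := by
    intro P
    have := hφ 1 P
    rwa [hL1, Complex.ofReal_one] at this
  have hσ : ∀ j, RpRat (fun s => ((σ (L s) j : ℝ) : ℂ)) := by
    intro j
    refine ⟨φ (N j), φ d, ?_, ?_⟩
    · rw [hφ0]
      exact_mod_cast hd t0 ht0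
    · filter_upwards [hLO] with s hs
      rw [hφ, hφ]
      exact_mod_cast hN _ hs j
  intro k
  have := rp_two (fun k => Polynomial.C (-Complex.I) * φ (r k)) (φ d)
    (by rw [hφ0]; exact_mod_cast hd t0 ht0)
    (by
      rintro k l hkl ⟨c, hc⟩
      have e0 := congrArg (Polynomial.eval 0) hc
      have e1 := congrArg (Polynomial.eval 1) hc
      simp only [Polynomial.eval_sub, Polynomial.eval_mul, Polynomial.eval_C, hφ0, hφ1] at e0 e1
      apply ht1 k l hkl
      simp only [M, map_sub, map_mul, MvPolynomial.eval_C]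
      have hI : (-Complex.I) ≠ 0 := neg_ne_zero.2 Complex.I_ne_zero
      apply Complex.ofReal_injective
      apply mul_left_cancel₀ hI
      push_cast
      linear_combination e1 * (MvPolynomial.eval t0 d : ℂ) - e0 * (MvPolynomial.eval t1 d : ℂ))
    (fun k s => MvPolynomial.eval (fun j => ((σ (L s) j : ℝ) : ℂ)) (A k) /
          MvPolynomial.eval (fun j => ((σ (L s) j : ℝ) : ℂ)) (B k))
    (fun k => (RpRat.mv _ hσ (A k)).div (RpRat.mv _ hσ (B k)) (by
      simp only [hL0]
      exact hB k t0 ht0))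
    (by
      filter_upwards [hLO] with s hs
      rw [← hzero _ hs]
      refine Finset.sum_congr rfl fun k _ => ?_
      congr 2
      rw [Polynomial.eval_mul, Polynomial.eval_C, hφ, hφ, ← hr _ hs k]
      have : ((MvPolynomial.eval (L s) d : ℝ) : ℂ) ≠ 0 := by exact_mod_cast hd _ hs
      push_cast
      field_simp) k
  simpa only [hL0] using this
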